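/- Let X be a finite subset of ℝ^n, k ≥ 0 an integer, let s_i be a phase-change number of X with next phase-change number s_{i+1}, and let r > 0 satisfy 2r < s_{i+1} − s_i. If (s_i, x) is a branch point of Γ_k(X), then (s_i, x) is a maximal branch point below (s_i + 2r, x): every branch point b of Γ_k(X) with b ≼ (s_i + 2r, x) satisfies b ≼ (s_i, x). -/

import Mathlib

open scoped Classical

noncomputable section

namespace DataHomotopy

/-- Points of `ℝ^n` with the Euclidean metric. -/
abbrev Pt (n : ℕ) := EuclideanSpace ℝ (Fin n)

/-- `σ` is a simplex of the Vietoris–Rips complex `V_s(X)`: a nonempty subset of `X`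
all of whose pairwise distances are at most `s`. -/
def IsVRSimplex {n : ℕ} (X : Finset (Pt n)) (s : ℝ) (σ : Finset (Pt n)) : Prop :=
  σ.Nonempty ∧ σ ⊆ X ∧ ∀ x ∈ σ, ∀ y ∈ σ, dist x y ≤ s

/-- `x` is a vertex of the Lesnick complex `L_{s,k}(X)`: `x ∈ X` and there are at least
`k` points of `X`, distinct from `x`, within distance `s` of `x`. -/
def IsLVertex {n : ℕ} (X : Finset (Pt n)) (k : ℕ) (s : ℝ) (x : Pt n) : Prop :=
  x ∈ X ∧ ∃ S : Finset (Pt n), S ⊆ X ∧ x ∉ S ∧ k ≤ S.card ∧ ∀ x' ∈ S, dist x x' ≤ s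

/-- `σ` is a simplex of the Lesnick complex `L_{s,k}(X)`: a Vietoris–Rips simplex all of
whose elements are vertices of `L_{s,k}(X)`. -/
def IsLSimplex {n : ℕ} (X : Finset (Pt n)) (k : ℕ) (s : ℝ) (σ : Finset (Pt n)) : Prop :=
  IsVRSimplex X s σ ∧ ∀ x ∈ σ, IsLVertex X k s x

/-- `x` and `y` lie in the same component of `L_{s,k}(X)`: both are vertices, and they are
joined by a finite chain of vertices with consecutive distances at most `s`. -/
def SameComp {n : ℕ} (X : Finset (Pt n)) (k : ℕ) (s : ℝ) (x y : Pt n) : Prop :=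
  IsLVertex X k s x ∧
    Relation.ReflTransGen (fun a b => IsLVertex X k s b ∧ dist a b ≤ s) x y

/-- `p = (s, x)` is an element of `Γ_k(X)`: `s ≥ 0` and `x` is a vertex of `L_{s,k}(X)`. -/
def InGamma {n : ℕ} (X : Finset (Pt n)) (k : ℕ) (p : ℝ × Pt n) : Prop :=
  0 ≤ p.1 ∧ IsLVertex X k p.1 p.2

/-- The preorder on `Γ_k(X)`: `(s, x) ≼ (t, y)` iff `s ≤ t` and `x`, `y` lie in the same
component of `L_{t,k}(X)`. -/
def GammaLe {n : ℕ} (X : Finset (Pt n)) (k : ℕ) (p q : ℝ × Pt n) : Prop :=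
  p.1 ≤ q.1 ∧ SameComp X k q.1 p.2 q.2

/-- `p = (t, x)` is a branch point of `Γ_k(X)`. -/
def IsBranch {n : ℕ} (X : Finset (Pt n)) (k : ℕ) (p : ℝ × Pt n) : Prop :=
  InGamma X k p ∧
    ((∃ s₀, s₀ < p.1 ∧ ∀ s, s₀ ≤ s → s < p.1 →
        ∃ x₀ x₁ : Pt n, IsLVertex X k s x₀ ∧ IsLVertex X k s x₁ ∧
          ¬ SameComp X k s x₀ x₁ ∧ GammaLe X k (s, x₀) p ∧ GammaLe X k (s, x₁) p) ∨
      ¬ ∃ q : ℝ × Pt n, q.1 < p.1 ∧ InGamma X k q ∧ GammaLe X k q p)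

/-- `c` is a least upper bound of `a` and `b` in `Γ_k(X)`. -/
def IsLUBIn {n : ℕ} (X : Finset (Pt n)) (k : ℕ) (a b c : ℝ × Pt n) : Prop :=
  InGamma X k c ∧ GammaLe X k a c ∧ GammaLe X k b c ∧
    ∀ c', InGamma X k c' → GammaLe X k a c' → GammaLe X k b c' → GammaLe X k c c'

/-- `b` is a maximal branch point below `a` in `Γ_k(X)`. -/
def IsMaxBranchBelow {n : ℕ} (X : Finset (Pt n)) (k : ℕ) (b a : ℝ × Pt n) : Prop :=
  IsBranch X k b ∧ GammaLe X k b a ∧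
    ∀ b', IsBranch X k b' → GammaLe X k b' a → GammaLe X k b' b

/-- The Euclidean distance on `(ℝ^n)^m ≅ ℝ^{nm}` between two `m`-tuples. -/
def tupleDist {n m : ℕ} (y x : Fin m → Pt n) : ℝ :=
  Real.sqrt (∑ i, dist (y i) (x i) ^ 2)

/-- `X^m_dis` is `r`-dense in `Y^m_dis`: every `m`-tuple of pairwise distinct points of `Y`
is within distance `< r` (in `ℝ^{nm}`) of an `m`-tuple of pairwise distinct points of `X`. -/
def ConfigDense {n : ℕ} (X Y : Finset (Pt n)) (m : ℕ) (r : ℝ) : Prop :=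
  ∀ y : Fin m → Pt n, (∀ i, y i ∈ Y) → Function.Injective y →
    ∃ x : Fin m → Pt n, (∀ i, x i ∈ X) ∧ Function.Injective x ∧ tupleDist y x < r

/-- `s` and `t` are consecutive phase-change numbers of `Y`: both are realized as distances
between points of `Y`, `s < t`, and no distance between points of `Y` lies strictly
between `s` and `t`. -/
def IsPhasePair {n : ℕ} (Y : Finset (Pt n)) (s t : ℝ) : Prop :=
  (∃ a ∈ Y, ∃ b ∈ Y, dist a b = s) ∧ (∃ a ∈ Y, ∃ b ∈ Y, dist a b = t) ∧
    s < t ∧ ∀ a ∈ Y, ∀ b ∈ Y, dist a b ≤ s ∨ t ≤ dist a b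

/-- `dS X k s x y = u - s`, where `u` is the least number `u ≥ s` such that `x` and `y`
lie in the same component of `L_{u,k}(X)`. -/
def dS {n : ℕ} (X : Finset (Pt n)) (k : ℕ) (s : ℝ) (x y : Pt n) : ℝ :=
  sInf {u : ℝ | s ≤ u ∧ SameComp X k u x y} - s

section Transfer

variable {n : ℕ} {X : Finset (Pt n)} {k : ℕ} {s t : ℝ} {x y z : Pt n}

theorem IsLVertex.of_dist_le (h : ∀ a ∈ X, ∀ b ∈ X, dist a b ≤ t → dist a b ≤ s)
    (hx : IsLVertex X k t x) : IsLVertex X k s x := by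
  obtain ⟨hxX, S, hS, hxS, hk, hd⟩ := hx
  exact ⟨hxX, S, hS, hxS, hk, fun x' hx' => h x hxX x' (hS hx') (hd x' hx')⟩

theorem SameComp.right (h : SameComp X k s x y) : IsLVertex X k s y := by
  obtain ⟨hx, hc⟩ := h
  cases hc with
  | refl => exact hx
  | tail _ hb => exact hb.1

theorem SameComp.of_dist_le (h : ∀ a ∈ X, ∀ b ∈ X, dist a b ≤ t → dist a b ≤ s)
    (hxy : SameComp X k t x y) : SameComp X k s x y := by
  obtain ⟨hx, hc⟩ := hxy
  refine ⟨hx.of_dist_le h, ?_⟩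
  induction hc with
  | refl => exact .refl
  | tail hab hb ih =>
    exact ih.tail ⟨hb.1.of_dist_le h, h _ (SameComp.right ⟨hx, hab⟩).1 _ hb.1.1 hb.2⟩

theorem SameComp.trans (hxy : SameComp X k s x y) (hyz : SameComp X k s y z) :
    SameComp X k s x z :=
  ⟨hxy.1, hxy.2.trans hyz.2⟩

theorem SameComp.symm (h : SameComp X k s x y) : SameComp X k s y x := by
  refine ⟨h.right, ?_⟩
  obtain ⟨hx, hc⟩ := h
  induction hc with
  | refl => exact .refl
  | tail hab hb ih =>
    exact .head ⟨SameComp.right ⟨hx, hab⟩, dist_comm (α := Pt n) _ _ ▸ hb.2⟩ ih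

/-- A branch point cannot occur at a scale `t` if the complex at scale `t` already agrees with
the one at a smaller nonnegative scale `s`. -/
theorem IsBranch.le_of_dist_le (hs : 0 ≤ s)
    (h : ∀ a ∈ X, ∀ b ∈ X, dist a b ≤ t → dist a b ≤ s) (hb : IsBranch X k (t, y)) :
    t ≤ s := by
  by_contra! hst
  obtain ⟨⟨-, hy⟩, ⟨s₀, hs₀, hsplit⟩ | hmin⟩ := hb
  · obtain ⟨x₀, x₁, -, -, hne, h₀, h₁⟩ :=
      hsplit (max s₀ s) (le_max_left _ _) (max_lt hs₀ hst)
    exact hne ((h₀.2.trans h₁.2.symm).of_dist_le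
      fun a ha b hb hab => (h a ha b hb hab).trans (le_max_right _ _))
  · exact hmin ⟨(s, y), hst, ⟨hs, hy.of_dist_le h⟩, hst.le, hy, .refl⟩

end Transfer

theorem stmt19 {n : ℕ} (X : Finset (Pt n)) (k : ℕ) (si sj : ℝ)
    (hphase : IsPhasePair X si sj) (r : ℝ) (hr : 0 < r) (hgap : 2 * r < sj - si)
    (x : Pt n) (hbr : IsBranch X k (si, x)) :
    IsMaxBranchBelow X k (si, x) (si + 2 * r, x) := by
  obtain ⟨-, -, -, hsep⟩ := hphase
  have hgapDist : ∀ t ≤ si + 2 * r, ∀ a ∈ X, ∀ b ∈ X, dist a b ≤ t → dist a b ≤ si := by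
    intro t ht a ha b hb hab
    rcases hsep a ha b hb with h | h <;> linarith
  have hle : si ≤ si + 2 * r := by linarith
  have hx : IsLVertex X k (si + 2 * r) x :=
    hbr.1.2.of_dist_le fun _ _ _ _ hab => hab.trans hle
  refine ⟨hbr, ⟨hle, hx, .refl⟩, ?_⟩
  rintro ⟨t, y⟩ hb ⟨ht, hyx⟩
  exact ⟨hb.le_of_dist_le hbr.1.1 (hgapDist t ht), hyx.of_dist_le (hgapDist _ le_rfl)⟩

end DataHomotopy
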